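/- arXiv:2510.14878 — 2 statements merged into one kernel-verified Lean document; each statement's English description precedes it below -/
import Mathlib

section
/- For every ρ ∈ [0,1) and all x, y ∈ ℝ, the series Σ_{n=0}^∞ ρ^n h_n(x) h_n(y) converges absolutely and equals (1−ρ²)^{−1/2} · exp( −(ρ²(x²+y²) − 2ρxy) / (2(1−ρ²)) ) (Mehler's formula). -/
/-- The monic probabilist's Hermite polynomial `He`, as a real function. -/
noncomputable def He (n : ℕ) (x : ℝ) : ℝ := Polynomial.aeval x (Polynomial.hermite n)

/-- The normalized probabilist's Hermite polynomial `h_n := He_n / √(n!)`. -/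
noncomputable def hermN (n : ℕ) (x : ℝ) : ℝ := He n x / Real.sqrt (Nat.factorial n)

open Complex in
theorem norm_cexp_neg_sq_div_two (z : ℝ) :
    ‖cexp (-(z : ℂ) ^ 2 / 2)‖ = Real.exp (-z ^ 2 / 2) := by
  rw [norm_exp]; congr 1; norm_cast

open Complex in
theorem norm_add_I_mul_sq (x z : ℝ) : ‖(x : ℂ) + I * z‖ ^ 2 = x ^ 2 + z ^ 2 := by
  rw [← normSq_eq_norm_sq, mul_comm, normSq_add_mul_I]

open MeasureTheory Complex in
/-- The complex moments `x + iz` against the unnormalized Gaussian weight are integrable. -/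
theorem integrable_pow_mul_gaussian (n : ℕ) (x : ℝ) :
    Integrable (fun z : ℝ => ((x : ℂ) + I * z) ^ n * cexp (-(z : ℂ) ^ 2 / 2)) := by
  refine Integrable.mono'
    ((integrable_exp_neg_mul_sq (by norm_num : (0 : ℝ) < 1 / 4)).const_mul
      (n.factorial * Real.exp (1 + x ^ 2 / 4)))
    (by fun_prop) (.of_forall fun z => ?_)
  have hpow := Real.pow_div_factorial_le_exp ‖(x : ℂ) + I * z‖ (norm_nonneg _) n
  rw [div_le_iff₀' (by positivity)] at hpow
  rw [norm_mul, norm_pow, norm_cexp_neg_sq_div_two]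
  calc ‖(x : ℂ) + I * z‖ ^ n * Real.exp (-z ^ 2 / 2)
      ≤ n.factorial * Real.exp ‖(x : ℂ) + I * z‖ * Real.exp (-z ^ 2 / 2) := by gcongr
    _ = n.factorial * Real.exp (‖(x : ℂ) + I * z‖ - z ^ 2 / 2) := by
        rw [mul_assoc, ← Real.exp_add]; ring_nf
    _ ≤ n.factorial * Real.exp (1 + x ^ 2 / 4 + -(1 / 4) * z ^ 2) := by
        gcongr
        nlinarith [sq_nonneg (‖(x : ℂ) + I * z‖ - 2), norm_add_I_mul_sq x z]
    _ = _ := by rw [Real.exp_add, mul_assoc]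

open Polynomial in
theorem derivative_hermite_succ (n : ℕ) :
    derivative (hermite (n + 1)) = (n + 1 : ℤ[X]) * hermite n := by
  induction n with
  | zero => simp
  | succ n ih =>
    rw [hermite_succ (n + 1), derivative_sub, derivative_mul, ih, derivative_mul, hermite_succ n]
    simp
    ring

theorem He_zero (x : ℝ) : He 0 x = 1 := by simp [He]

theorem He_one (x : ℝ) : He 1 x = x := by simp [He]

theorem He_add_two (n : ℕ) (x : ℝ) : He (n + 2) x = x * He (n + 1) x - (n + 1) * He n x := by
  unfold He
  rw [Polynomial.hermite_succ (n + 1), derivative_hermite_succ]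
  simp

open MeasureTheory Complex in
/-- Gaussian integration by parts for the moments of `x + iz`. -/
theorem integral_pow_mul_gaussian_add_two (n : ℕ) (x : ℝ) :
    ∫ z : ℝ, ((x : ℂ) + I * z) ^ (n + 2) * cexp (-(z : ℂ) ^ 2 / 2) =
      x * (∫ z : ℝ, ((x : ℂ) + I * z) ^ (n + 1) * cexp (-(z : ℂ) ^ 2 / 2)) -
        (n + 1) * ∫ z : ℝ, ((x : ℂ) + I * z) ^ n * cexp (-(z : ℂ) ^ 2 / 2) := by
  have h0 := integrable_pow_mul_gaussian n x
  have h1 := integrable_pow_mul_gaussian (n + 1) x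
  have h2 := integrable_pow_mul_gaussian (n + 2) x
  have hderiv (z : ℝ) : HasDerivAt
      (fun z : ℝ => ((x : ℂ) + I * z) ^ (n + 1) * cexp (-(z : ℂ) ^ 2 / 2))
      (I * (((x : ℂ) + I * z) ^ (n + 2) * cexp (-(z : ℂ) ^ 2 / 2) -
        x * (((x : ℂ) + I * z) ^ (n + 1) * cexp (-(z : ℂ) ^ 2 / 2)) +
        (n + 1) * (((x : ℂ) + I * z) ^ n * cexp (-(z : ℂ) ^ 2 / 2)))) z := by
    have hid : HasDerivAt (fun z : ℝ => (z : ℂ)) 1 z := ofRealCLM.hasDerivAt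
    have hlin := ((hid.const_mul I).const_add (x : ℂ)).fun_pow (n + 1)
    have hexp := ((hid.fun_pow 2).fun_neg.div_const 2).cexp
    convert! hlin.fun_mul hexp using 1
    push_cast
    linear_combination (((x : ℂ) + I * z) ^ (n + 1) * z * cexp (-(z : ℂ) ^ 2 / 2)) * I_sq
  have hsub : Integrable (fun z : ℝ => ((x : ℂ) + I * z) ^ (n + 2) * cexp (-(z : ℂ) ^ 2 / 2) -
      x * (((x : ℂ) + I * z) ^ (n + 1) * cexp (-(z : ℂ) ^ 2 / 2))) := h2.sub (h1.const_mul _)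
  have hint := integral_eq_zero_of_hasDerivAt_of_integrable hderiv
    ((hsub.add (h0.const_mul _)).const_mul _) h1
  rw [integral_const_mul, integral_add hsub (h0.const_mul _),
    integral_sub h2 (h1.const_mul _), integral_const_mul, integral_const_mul] at hint
  linear_combination (mul_eq_zero.mp hint).resolve_left I_ne_zero

open MeasureTheory Complex in
theorem integral_cexp_neg_sq_div_two :
    ∫ z : ℝ, cexp (-(z : ℂ) ^ 2 / 2) = (√(2 * Real.pi) : ℝ) := by
  rw [show 2 * Real.pi = Real.pi / (1 / 2) by ring, ← integral_gaussian, ← integral_complex_ofReal]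
  congr 1 with z
  push_cast
  ring_nf

open MeasureTheory Complex in
theorem integral_pow_mul_gaussian_eq_He (n : ℕ) (x : ℝ) :
    ∫ z : ℝ, ((x : ℂ) + I * z) ^ n * cexp (-(z : ℂ) ^ 2 / 2) =
      (√(2 * Real.pi) * He n x : ℝ) := by
  induction n using Nat.twoStepInduction with
  | zero => simpa [He_zero] using integral_cexp_neg_sq_div_two
  | one =>
    have hodd : ∫ z : ℝ, (z : ℂ) * cexp (-(z : ℂ) ^ 2 / 2) = 0 := by
      have h := integral_neg_eq_self (fun z : ℝ => (z : ℂ) * cexp (-(z : ℂ) ^ 2 / 2)) volume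
      simp only [ofReal_neg, neg_sq, neg_mul, integral_neg] at h
      exact self_eq_neg.mp h.symm
    have h0 : Integrable (fun z : ℝ => cexp (-(z : ℂ) ^ 2 / 2)) := by
      simpa using integrable_pow_mul_gaussian 0 x
    have h1 : Integrable (fun z : ℝ => I * ((z : ℂ) * cexp (-(z : ℂ) ^ 2 / 2))) := by
      simpa [mul_assoc] using integrable_pow_mul_gaussian 1 0
    simp only [pow_one, add_mul, mul_assoc, He_one]
    rw [integral_add (h0.const_mul _) h1, integral_const_mul, integral_const_mul, hodd,
      integral_cexp_neg_sq_div_two]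
    push_cast
    ring
  | more n ih ih1 =>
    rw [integral_pow_mul_gaussian_add_two, ih, ih1, He_add_two]
    push_cast
    ring

open Complex in
theorem hasSum_pow_div_factorial_cexp (a : ℂ) :
    HasSum (fun n : ℕ => a ^ n / n.factorial) (cexp a) := by
  rw [exp_eq_exp_ℂ]
  exact NormedSpace.expSeries_div_hasSum_exp a

theorem hasSum_pow_div_factorial_exp (a : ℝ) :
    HasSum (fun n : ℕ => a ^ n / n.factorial) (Real.exp a) := by
  rw [Real.exp_eq_exp_ℝ]
  exact NormedSpace.expSeries_div_hasSum_exp a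

open MeasureTheory Complex in
/-- The dominating function for the exponential series of `ρ (x + iz) (y + iw)` is integrable. -/
theorem integrable_exp_norm_mul_gaussian {ρ : ℝ} (h0 : 0 ≤ ρ) (h1 : ρ < 1) (x y : ℝ) :
    Integrable (fun p : ℝ × ℝ => Real.exp (ρ * ‖(x : ℂ) + I * p.1‖ * ‖(y : ℂ) + I * p.2‖) *
      (Real.exp (-p.1 ^ 2 / 2) * Real.exp (-p.2 ^ 2 / 2))) := by
  have hg := integrable_exp_neg_mul_sq (by linarith : (0 : ℝ) < (1 - ρ) / 2)
  refine Integrable.mono' ((hg.mul_prod hg).const_mul (Real.exp (ρ * (x ^ 2 + y ^ 2) / 2)))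
    (by fun_prop) (.of_forall fun p => ?_)
  rw [Real.norm_of_nonneg (by positivity)]
  simp only [← Real.exp_add]
  rw [Real.exp_le_exp]
  have := mul_nonneg h0 (sq_nonneg (‖(x : ℂ) + I * p.1‖ - ‖(y : ℂ) + I * p.2‖))
  linear_combination this / 2 + ρ / 2 * norm_add_I_mul_sq x p.1 + ρ / 2 * norm_add_I_mul_sq y p.2

open MeasureTheory Complex in
theorem integral_cexp_mul_gaussian {ρ : ℝ} (h0 : 0 ≤ ρ) (h1 : ρ < 1) (x y : ℝ) :
    ∫ p : ℝ × ℝ, cexp (ρ * ((x : ℂ) + I * p.1) * ((y : ℂ) + I * p.2)) *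
        (cexp (-(p.1 : ℂ) ^ 2 / 2) * cexp (-(p.2 : ℂ) ^ 2 / 2)) =
      (2 * Real.pi * ((1 / √(1 - ρ ^ 2)) *
        Real.exp (-(ρ ^ 2 * (x ^ 2 + y ^ 2) - 2 * ρ * x * y) / (2 * (1 - ρ ^ 2)))) : ℝ) := by
  have hpos : 0 < 1 - ρ ^ 2 := by nlinarith
  have hint : Integrable (fun p : ℝ × ℝ =>
      cexp (ρ * ((x : ℂ) + I * p.1) * ((y : ℂ) + I * p.2)) *
        (cexp (-(p.1 : ℂ) ^ 2 / 2) * cexp (-(p.2 : ℂ) ^ 2 / 2))) := by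
    refine (integrable_exp_norm_mul_gaussian h0 h1 x y).mono' (by fun_prop) (.of_forall fun p => ?_)
    rw [norm_mul, norm_mul, norm_cexp_neg_sq_div_two, norm_cexp_neg_sq_div_two]
    gcongr
    refine (norm_exp_le_exp_norm _).trans_eq ?_
    rw [norm_mul, norm_mul, norm_real, Real.norm_of_nonneg h0]
  have hsqrt {a : ℝ} (ha : 0 ≤ a) : (a : ℂ) ^ (1 / 2 : ℂ) = (√a : ℝ) := by
    rw [Real.sqrt_eq_rpow, ofReal_cpow ha]
    norm_num
  have hinner (z : ℝ) : ∫ w : ℝ, cexp (ρ * ((x : ℂ) + I * z) * ((y : ℂ) + I * w)) *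
      (cexp (-(z : ℂ) ^ 2 / 2) * cexp (-(w : ℂ) ^ 2 / 2)) =
      (√(2 * Real.pi) : ℝ) * cexp (-((1 - ρ ^ 2) / 2) * (z : ℂ) ^ 2 +
        I * ρ * (y - ρ * x) * z + (ρ * x * y - ρ ^ 2 * x ^ 2 / 2)) := by
    have h := integral_cexp_quadratic (b := -(1 / 2)) (by norm_num)
      (I * ρ * ((x : ℂ) + I * z)) (ρ * ((x : ℂ) + I * z) * y - z ^ 2 / 2)
    rw [← hsqrt (by positivity)]
    convert h using 2
    · ext w
      rw [← Complex.exp_add, ← Complex.exp_add]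
      ring_nf
    · push_cast; ring_nf
    · congr 1
      linear_combination (-(ρ ^ 2 : ℂ) * x ^ 2 / 2 - ρ ^ 2 * x * I * z -
        ρ ^ 2 * z ^ 2 / 2 * (I ^ 2 - 1)) * I_sq
  rw [Measure.volume_eq_prod] at hint ⊢
  rw [integral_prod _ hint]
  simp only [hinner]
  have hb : (-((1 - ρ ^ 2) / 2) : ℂ) = (-((1 - ρ ^ 2) / 2) : ℝ) := by push_cast; rfl
  rw [integral_const_mul, integral_cexp_quadratic (by rw [hb, ofReal_re]; linarith)]
  have hdet : (Real.pi : ℂ) / -(-((1 - ρ ^ 2) / 2)) = (2 * Real.pi / (1 - ρ ^ 2) : ℝ) := by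
    push_cast
    rw [neg_neg, div_div_eq_mul_div, mul_comm]
  have hexp : (ρ * x * y - ρ ^ 2 * x ^ 2 / 2 - (I * ρ * (y - ρ * x)) ^ 2 /
      (4 * -((1 - ρ ^ 2) / 2)) : ℂ) =
      (-(ρ ^ 2 * (x ^ 2 + y ^ 2) - 2 * ρ * x * y) / (2 * (1 - ρ ^ 2)) : ℝ) := by
    have hne : (1 - ρ ^ 2 : ℂ) ≠ 0 := by exact_mod_cast hpos.ne'
    rw [mul_pow, mul_pow, I_sq]
    push_cast
    field_simp
    ring
  rw [hdet, hsqrt (by positivity), hexp, ← ofReal_exp, ← ofReal_mul, ← ofReal_mul,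
    Real.sqrt_div (by positivity)]
  congr 1
  linear_combination (1 / √(1 - ρ ^ 2) *
    Real.exp (-(ρ ^ 2 * (x ^ 2 + y ^ 2) - 2 * ρ * x * y) / (2 * (1 - ρ ^ 2)))) *
    Real.mul_self_sqrt (by positivity : 0 ≤ 2 * Real.pi)

open MeasureTheory Complex in
theorem hasSum_mehler {ρ : ℝ} (h0 : 0 ≤ ρ) (h1 : ρ < 1) (x y : ℝ) :
    HasSum (fun n : ℕ => ρ ^ n * hermN n x * hermN n y)
      ((1 / √(1 - ρ ^ 2)) *
        Real.exp (-(ρ ^ 2 * (x ^ 2 + y ^ 2) - 2 * ρ * x * y) / (2 * (1 - ρ ^ 2)))) := by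
  let W (p : ℝ × ℝ) : ℂ := cexp (-(p.1 : ℂ) ^ 2 / 2) * cexp (-(p.2 : ℂ) ^ 2 / 2)
  let F (n : ℕ) (p : ℝ × ℝ) : ℂ :=
    (ρ * ((x : ℂ) + I * p.1) * ((y : ℂ) + I * p.2)) ^ n / n.factorial * W p
  have hF (n : ℕ) : ∫ p, F n p =
      (2 * Real.pi * (ρ ^ n * hermN n x * hermN n y) : ℝ) := by
    have hsplit (p : ℝ × ℝ) : F n p = ((ρ : ℂ) ^ n / n.factorial) *
        ((((x : ℂ) + I * p.1) ^ n * cexp (-(p.1 : ℂ) ^ 2 / 2)) *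
          (((y : ℂ) + I * p.2) ^ n * cexp (-(p.2 : ℂ) ^ 2 / 2))) := by
      simp only [F, W, mul_pow]
      ring
    simp only [hsplit]
    rw [integral_const_mul, Measure.volume_eq_prod,
      integral_prod_mul (fun z : ℝ => ((x : ℂ) + I * z) ^ n * cexp (-(z : ℂ) ^ 2 / 2))
        (fun z : ℝ => ((y : ℂ) + I * z) ^ n * cexp (-(z : ℂ) ^ 2 / 2)),
      integral_pow_mul_gaussian_eq_He, integral_pow_mul_gaussian_eq_He]
    norm_cast
    have hherm : hermN n x * hermN n y = He n x * He n y / n.factorial := by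
      rw [hermN, hermN, div_mul_div_comm, Real.mul_self_sqrt (by positivity)]
    rw [mul_assoc (ρ ^ n), hherm]
    linear_combination (ρ ^ n / n.factorial * He n x * He n y) *
      Real.mul_self_sqrt (by positivity : 0 ≤ 2 * Real.pi)
  have hnormF (n : ℕ) (p : ℝ × ℝ) : ‖F n p‖ =
      (ρ * ‖(x : ℂ) + I * p.1‖ * ‖(y : ℂ) + I * p.2‖) ^ n / n.factorial *
        (Real.exp (-p.1 ^ 2 / 2) * Real.exp (-p.2 ^ 2 / 2)) := by
    simp only [F, W, norm_mul, norm_div, norm_pow, norm_real, Real.norm_of_nonneg h0,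
      norm_cexp_neg_sq_div_two, Complex.norm_natCast]
  have hbound (p : ℝ × ℝ) : HasSum (fun n => ‖F n p‖)
      (Real.exp (ρ * ‖(x : ℂ) + I * p.1‖ * ‖(y : ℂ) + I * p.2‖) *
        (Real.exp (-p.1 ^ 2 / 2) * Real.exp (-p.2 ^ 2 / 2))) := by
    simp only [hnormF]
    exact (hasSum_pow_div_factorial_exp _).mul_right _
  have hsum := hasSum_integral_of_dominated_convergence (μ := volume) (F := F)
    (f := fun p => cexp (ρ * ((x : ℂ) + I * p.1) * ((y : ℂ) + I * p.2)) * W p)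
    (fun n p => ‖F n p‖) (fun n => by fun_prop) (fun n => .of_forall fun p => le_rfl)
    (.of_forall fun p => (hbound p).summable)
    (by simpa only [(hbound _).tsum_eq] using integrable_exp_norm_mul_gaussian h0 h1 x y)
    (.of_forall fun p => (hasSum_pow_div_factorial_cexp _).mul_right _)
  simp only [hF, W] at hsum
  rw [integral_cexp_mul_gaussian h0 h1, hasSum_ofReal] at hsum
  exact (hasSum_mul_left_iff (by positivity)).mp hsum

/-- **Mehler's formula**: for every `ρ ∈ [0,1)` and all `x, y ∈ ℝ`, the series
`Σ_n ρ^n h_n(x) h_n(y)` converges absolutely and equals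
`(1−ρ²)^{−1/2} exp(−(ρ²(x²+y²) − 2ρxy)/(2(1−ρ²)))`. -/
theorem mehler_formula (ρ : ℝ) (hρ : ρ ∈ Set.Ico (0 : ℝ) 1) (x y : ℝ) :
    Summable (fun n : ℕ => |ρ ^ n * hermN n x * hermN n y|) ∧
    (∑' n : ℕ, ρ ^ n * hermN n x * hermN n y)
      = (1 / Real.sqrt (1 - ρ ^ 2)) *
          Real.exp (-(ρ ^ 2 * (x ^ 2 + y ^ 2) - 2 * ρ * x * y) / (2 * (1 - ρ ^ 2))) := by
  have h := hasSum_mehler hρ.1 hρ.2 x y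
  exact ⟨summable_abs_iff.mpr h.summable, h.tsum_eq⟩
end

section
/- For every n ∈ ℕ, the function f(τ) := ⟨h_n, T_τ h_n⟩_{L²(γ)} is smooth in a neighborhood of τ = 0 with f(0) = 1, f′(0) = 0 and f″(0) = −(n²+n+1)/2; consequently f(τ) = 1 − ((n²+n+1)/4)·τ² + O(τ³) and arccos f(τ) = √((n²+n+1)/2)·|τ| + O(τ²) as τ → 0. -/
open MeasureTheory Asymptotics

/-- The standard Gaussian measure `N(0,1)` on `ℝ`. -/
noncomputable def stdGaussian : Measure ℝ := ProbabilityTheory.gaussianReal 0 1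

/-- The squeezing operator `(T_τ f)(x) = e^{τ/2} e^{−((e^{2τ}−1)/4)x²} f(e^τ x)`. -/
noncomputable def squeeze (τ : ℝ) (f : ℝ → ℝ) : ℝ → ℝ :=
  fun x => Real.exp (τ / 2) * Real.exp (-((Real.exp (2 * τ) - 1) / 4) * x ^ 2) *
    f (Real.exp τ * x)

/-- The overlap `f(τ) = ⟨h_n, T_τ h_n⟩_{L²(γ)}`. -/
noncomputable def overlapFn (n : ℕ) (τ : ℝ) : ℝ :=
  ∫ x, hermN n x * squeeze τ (hermN n) x ∂stdGaussian

/-- The Hermite polynomials with real coefficients. -/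
noncomputable def hermiteReal (n : ℕ) : Polynomial ℝ :=
  (Polynomial.hermite n).map (Int.castRingHom ℝ)

/-- The creation operator, multiplication by `X` minus differentiation, on polynomials. -/
noncomputable def hermiteRaise (p : Polynomial ℝ) : Polynomial ℝ :=
  Polynomial.X * p - Polynomial.derivative p

/-- The generator `1 / 2 + X d/dX - X² / 2` of the squeezing group. -/
noncomputable def squeezeGen (p : Polynomial ℝ) : Polynomial ℝ :=
  Polynomial.C (1 / 2) * p + Polynomial.X * Polynomial.derivative p
    - Polynomial.C (1 / 2) * Polynomial.X ^ 2 * p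

/-- The expectation of a polynomial under the standard Gaussian. -/
noncomputable def gaussExp (p : Polynomial ℝ) : ℝ := ∫ x, p.eval x ∂stdGaussian

/-- The matrix coefficient `⟨p, T_τ q⟩` of the squeezing operator between polynomials. -/
noncomputable def polyOverlap (p q : Polynomial ℝ) (τ : ℝ) : ℝ :=
  ∫ x, p.eval x * squeeze τ (fun y => q.eval y) x ∂stdGaussian

instance : IsProbabilityMeasure stdGaussian := by
  unfold stdGaussian; infer_instance

lemma integrable_stdGaussian_iff {g : ℝ → ℝ} :
    Integrable g stdGaussian ↔
      Integrable (fun x => ProbabilityTheory.gaussianPDFReal 0 1 x * g x) := by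
  rw [stdGaussian, ProbabilityTheory.gaussianReal_of_var_ne_zero _ one_ne_zero,
    integrable_withDensity_iff_integrable_smul'
      (ProbabilityTheory.measurable_gaussianPDF _ _)
      (Filter.Eventually.of_forall fun _ => ProbabilityTheory.gaussianPDF_lt_top)]
  simp [ProbabilityTheory.toReal_gaussianPDF]

lemma integrable_exp_mul_sq_stdGaussian {c : ℝ} (hc : c < 1 / 2) :
    Integrable (fun x => Real.exp (c * x ^ 2)) stdGaussian := by
  rw [integrable_stdGaussian_iff]
  have h := (integrable_exp_neg_mul_sq (sub_pos.2 hc)).const_mul (√(2 * Real.pi))⁻¹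
  refine h.congr (Filter.Eventually.of_forall fun x => ?_)
  simp only [ProbabilityTheory.gaussianPDFReal, NNReal.coe_one, mul_one, sub_zero, mul_assoc,
    ← Real.exp_add]
  ring_nf

lemma Polynomial.exists_abs_eval_le_exp_sq (p : Polynomial ℝ) {ε : ℝ} (hε : 0 < ε) :
    ∃ C, 0 ≤ C ∧ ∀ x, |p.eval x| ≤ C * Real.exp (ε * x ^ 2) := by
  induction p using Polynomial.induction_on' with
  | add p q hp hq =>
    obtain ⟨C, hC, h⟩ := hp
    obtain ⟨D, hD, h'⟩ := hq
    refine ⟨C + D, add_nonneg hC hD, fun x => ?_⟩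
    rw [Polynomial.eval_add, add_mul]
    exact (abs_add_le _ _).trans (add_le_add (h x) (h' x))
  | monomial k a =>
    refine ⟨|a| * (1 + k.factorial / ε ^ k), by positivity, fun x => ?_⟩
    have h1 : 1 ≤ Real.exp (ε * x ^ 2) := Real.one_le_exp (by positivity)
    have h2 := Real.pow_div_factorial_le_exp (x := ε * x ^ 2) (by positivity) k
    have h3 : |x| ^ k ≤ 1 + (x ^ 2) ^ k := by
      rw [← sq_abs, ← pow_mul, mul_comm, pow_mul]
      nlinarith [sq_nonneg (|x| ^ k - 1)]
    have h4 : (x ^ 2) ^ k ≤ k.factorial / ε ^ k * Real.exp (ε * x ^ 2) := by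
      rw [mul_pow, div_le_iff₀ (by positivity)] at h2
      rw [div_mul_eq_mul_div, le_div_iff₀ (by positivity)]
      linarith
    rw [Polynomial.eval_monomial, abs_mul, abs_pow, mul_assoc]
    refine mul_le_mul_of_nonneg_left ?_ (abs_nonneg a)
    linarith

lemma integrable_polynomial_stdGaussian (p : Polynomial ℝ) :
    Integrable (fun x => p.eval x) stdGaussian := by
  obtain ⟨C, -, h⟩ := p.exists_abs_eval_le_exp_sq (ε := 1 / 4) (by norm_num)
  refine ((integrable_exp_mul_sq_stdGaussian (c := 1 / 4) (by norm_num)).const_mul C).mono'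
    p.continuous.aestronglyMeasurable (Filter.Eventually.of_forall h)

lemma gaussExp_add (p q : Polynomial ℝ) : gaussExp (p + q) = gaussExp p + gaussExp q := by
  simp only [gaussExp, Polynomial.eval_add]
  exact integral_add (integrable_polynomial_stdGaussian p) (integrable_polynomial_stdGaussian q)

lemma gaussExp_sub (p q : Polynomial ℝ) : gaussExp (p - q) = gaussExp p - gaussExp q := by
  simp only [gaussExp, Polynomial.eval_sub]
  exact integral_sub (integrable_polynomial_stdGaussian p) (integrable_polynomial_stdGaussian q)

lemma gaussExp_C_mul (a : ℝ) (p : Polynomial ℝ) :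
    gaussExp (Polynomial.C a * p) = a * gaussExp p := by
  simp only [gaussExp, Polynomial.eval_mul, Polynomial.eval_C]
  exact integral_const_mul _ _

lemma gaussExp_one : gaussExp 1 = 1 := by simp [gaussExp]

lemma gaussExp_zero : gaussExp 0 = 0 := by simp [gaussExp]

lemma gaussExp_hermiteRaise (p : Polynomial ℝ) : gaussExp (hermiteRaise p) = 0 := by
  rw [gaussExp, stdGaussian,
    ProbabilityTheory.integral_gaussianReal_eq_integral_smul one_ne_zero]
  simp only [smul_eq_mul]
  refine integral_eq_zero_of_hasDerivAt_of_integrable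
    (f := fun x => -(ProbabilityTheory.gaussianPDFReal 0 1 x * p.eval x)) (fun x => ?_)
    (integrable_stdGaussian_iff.1 (integrable_polynomial_stdGaussian _))
    (integrable_stdGaussian_iff.1 (integrable_polynomial_stdGaussian p)).neg
  have h1 : HasDerivAt (fun x : ℝ => -(x - 0) ^ 2 / (2 * ((1 : NNReal) : ℝ))) (-x) x := by
    have := ((((hasDerivAt_id x).sub_const 0).pow 2).neg).div_const (2 * ((1 : NNReal) : ℝ))
    refine this.congr_deriv ?_
    simp
    ring
  have h2 := ((h1.exp.const_mul (√(2 * Real.pi * (1 : NNReal)))⁻¹).mul (p.hasDerivAt x)).neg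
  refine h2.congr_deriv ?_
  simp only [hermiteRaise, ProbabilityTheory.gaussianPDFReal, Polynomial.eval_sub,
    Polynomial.eval_mul, Polynomial.eval_X]
  ring

lemma gaussExp_mul_hermiteRaise (p q : Polynomial ℝ) :
    gaussExp (p * hermiteRaise q) = gaussExp (Polynomial.derivative p * q) := by
  have h := gaussExp_hermiteRaise (p * q)
  have : hermiteRaise (p * q) = p * hermiteRaise q - Polynomial.derivative p * q := by
    simp only [hermiteRaise, Polynomial.derivative_mul]; ring
  rw [this, gaussExp_sub] at h
  linarith

lemma hermiteReal_zero : hermiteReal 0 = 1 := by simp [hermiteReal]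

lemma hermiteReal_succ (n : ℕ) : hermiteReal (n + 1) = hermiteRaise (hermiteReal n) := by
  simp [hermiteReal, hermiteRaise, Polynomial.hermite_succ, Polynomial.derivative_map]

lemma derivative_hermiteReal_succ (n : ℕ) :
    Polynomial.derivative (hermiteReal (n + 1)) = Polynomial.C ((n : ℝ) + 1) * hermiteReal n := by
  induction n with
  | zero => simp [hermiteReal_succ, hermiteReal_zero, hermiteRaise]
  | succ n ih =>
    rw [hermiteReal_succ, hermiteRaise, Polynomial.derivative_sub, Polynomial.derivative_mul, ih,
      Polynomial.derivative_C_mul, hermiteReal_succ n, hermiteRaise]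
    simp only [Polynomial.derivative_X, Polynomial.C_add, Nat.cast_add, Nat.cast_one,
      Polynomial.C_1]
    ring

lemma hermiteRaise_derivative_hermiteReal (n : ℕ) :
    hermiteRaise (Polynomial.derivative (hermiteReal n)) =
      Polynomial.C (n : ℝ) * hermiteReal n := by
  cases n with
  | zero => simp [hermiteReal_zero, hermiteRaise]
  | succ n =>
    have h : hermiteRaise (Polynomial.C ((n : ℝ) + 1) * hermiteReal n) =
        Polynomial.C ((n : ℝ) + 1) * hermiteRaise (hermiteReal n) := by
      simp only [hermiteRaise, Polynomial.derivative_C_mul]; ring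
    rw [derivative_hermiteReal_succ, h, hermiteReal_succ, Nat.cast_succ]

lemma gaussExp_hermiteReal_sq (n : ℕ) :
    gaussExp (hermiteReal n * hermiteReal n) = n.factorial := by
  induction n with
  | zero => simp [hermiteReal_zero, gaussExp_one]
  | succ n ih =>
    nth_rw 2 [hermiteReal_succ]
    rw [gaussExp_mul_hermiteRaise, derivative_hermiteReal_succ, mul_assoc, gaussExp_C_mul, ih,
      Nat.factorial_succ]
    push_cast; ring

lemma gaussExp_mul_hermiteReal (p : Polynomial ℝ) (n : ℕ) :
    gaussExp (p * hermiteReal n) = gaussExp (Polynomial.derivative^[n] p) := by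
  induction n generalizing p with
  | zero => simp [hermiteReal_zero]
  | succ n ih => rw [hermiteReal_succ, gaussExp_mul_hermiteRaise, ih, Function.iterate_succ_apply]

lemma natDegree_hermiteReal_le (n : ℕ) : (hermiteReal n).natDegree ≤ n :=
  Polynomial.natDegree_map_le.trans Polynomial.natDegree_hermite.le

lemma squeezeGen_eq (p : Polynomial ℝ) :
    squeezeGen p = Polynomial.C (1 / 2) * (Polynomial.derivative (Polynomial.derivative p)
      - hermiteRaise (hermiteRaise p)) := by
  have h : (Polynomial.C (1 / 2) : Polynomial ℝ) * 2 = 1 := by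
    rw [← Polynomial.C_ofNat, ← Polynomial.C_mul]; norm_num
  simp only [squeezeGen, hermiteRaise, Polynomial.derivative_sub, Polynomial.derivative_mul,
    Polynomial.derivative_X]
  linear_combination (-(Polynomial.X * Polynomial.derivative p)) * h

lemma gaussExp_mul_squeezeGen (p q : Polynomial ℝ) :
    gaussExp (p * squeezeGen q) = -gaussExp (squeezeGen p * q) := by
  have h1 := gaussExp_mul_hermiteRaise p (hermiteRaise q)
  have h2 := gaussExp_mul_hermiteRaise (Polynomial.derivative p) q
  have h3 := gaussExp_mul_hermiteRaise q (hermiteRaise p)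
  have h4 := gaussExp_mul_hermiteRaise (Polynomial.derivative q) p
  have e1 : p * squeezeGen q = Polynomial.C (1 / 2) *
      (Polynomial.derivative (Polynomial.derivative q) * p - p * hermiteRaise (hermiteRaise q)) := by
    rw [squeezeGen_eq]; ring
  have e2 : squeezeGen p * q = Polynomial.C (1 / 2) *
      (Polynomial.derivative (Polynomial.derivative p) * q - q * hermiteRaise (hermiteRaise p)) := by
    rw [squeezeGen_eq]; ring
  rw [e1, e2, gaussExp_C_mul, gaussExp_C_mul, gaussExp_sub, gaussExp_sub]
  linarith

lemma gaussExp_hermiteReal_mul_squeezeGen (n : ℕ) :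
    gaussExp (hermiteReal n * squeezeGen (hermiteReal n)) = 0 := by
  have h := gaussExp_mul_squeezeGen (hermiteReal n) (hermiteReal n)
  rw [mul_comm (squeezeGen _)] at h
  linarith

lemma gaussExp_hermiteReal_mul_squeezeGen_squeezeGen (n : ℕ) :
    gaussExp (hermiteReal n * squeezeGen (squeezeGen (hermiteReal n))) =
      -(((n : ℝ) ^ 2 + n + 1) / 2) * n.factorial := by
  set h := hermiteReal n with hh
  set a := Polynomial.derivative (Polynomial.derivative h) with ha
  set b := hermiteReal (n + 2) with hb
  have hG : squeezeGen h = Polynomial.C (1 / 2) * (a - b) := by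
    rw [squeezeGen_eq, hb, hermiteReal_succ, hermiteReal_succ]
  have hbb : gaussExp (b * b) = ((n : ℝ) + 2) * (n + 1) * n.factorial := by
    rw [hb, gaussExp_hermiteReal_sq, Nat.factorial_succ, Nat.factorial_succ]
    push_cast; ring
  have hab : gaussExp (a * b) = 0 := by
    rw [hb, gaussExp_mul_hermiteReal, Polynomial.iterate_derivative_eq_zero, gaussExp_zero]
    have h1 : a.natDegree ≤ _ := Polynomial.natDegree_derivative_le (Polynomial.derivative h)
    have h2 := Polynomial.natDegree_derivative_le h
    have h3 : h.natDegree ≤ n := natDegree_hermiteReal_le n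
    omega
  have haa : gaussExp (a * a) = (n : ℝ) * (n - 1) * n.factorial := by
    have hN := hermiteRaise_derivative_hermiteReal n
    have hN' : hermiteRaise a = Polynomial.C ((n : ℝ) - 1) * Polynomial.derivative h := by
      have := congrArg Polynomial.derivative hN
      simp only [hermiteRaise, Polynomial.derivative_sub, Polynomial.derivative_mul,
        Polynomial.derivative_X, Polynomial.derivative_C, ← hh] at this
      rw [Polynomial.C_sub, Polynomial.C_1, hermiteRaise, ha]
      linear_combination this
    rw [← gaussExp_mul_hermiteRaise, hN',
      show Polynomial.derivative h * (Polynomial.C ((n : ℝ) - 1) * Polynomial.derivative h) =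
        Polynomial.C ((n : ℝ) - 1) * (Polynomial.derivative h * Polynomial.derivative h) by ring,
      gaussExp_C_mul, ← gaussExp_mul_hermiteRaise, hN, ← hh,
      show h * (Polynomial.C (n : ℝ) * h) = Polynomial.C (n : ℝ) * (h * h) by ring,
      gaussExp_C_mul, hh, gaussExp_hermiteReal_sq]
    ring
  rw [gaussExp_mul_squeezeGen, hG,
    show Polynomial.C (1 / 2) * (a - b) * (Polynomial.C (1 / 2) * (a - b)) =
      Polynomial.C (1 / 2) * (Polynomial.C (1 / 2) * (a * a - Polynomial.C 2 * (a * b) + b * b)) by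
        rw [Polynomial.C_ofNat]; ring,
    gaussExp_C_mul, gaussExp_C_mul, gaussExp_add, gaussExp_sub, gaussExp_C_mul, haa, hab, hbb]
  ring

lemma polyOverlap_zero (p q : Polynomial ℝ) : polyOverlap p q 0 = gaussExp (p * q) := by
  simp [polyOverlap, gaussExp, squeeze]

lemma hasDerivAt_squeeze (q : Polynomial ℝ) (x τ : ℝ) :
    HasDerivAt (fun τ => squeeze τ (fun y => q.eval y) x)
      (squeeze τ (fun y => (squeezeGen q).eval y) x) τ := by
  have h1 : HasDerivAt (fun τ : ℝ => Real.exp (τ / 2)) (Real.exp (τ / 2) * (1 / 2)) τ :=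
    ((hasDerivAt_id τ).div_const 2).exp
  have h2 : HasDerivAt (fun τ : ℝ => Real.exp (2 * τ)) (Real.exp (2 * τ) * (2 * 1)) τ :=
    ((hasDerivAt_id τ).const_mul 2).exp
  have h3 := ((((h2.sub_const 1).div_const 4).neg).mul_const (x ^ 2)).exp
  have h4 := (q.hasDerivAt (Real.exp τ * x)).comp τ ((Real.hasDerivAt_exp τ).mul_const x)
  refine ((h1.mul h3).mul h4).congr_deriv ?_
  have e : Real.exp (2 * τ) = Real.exp τ ^ 2 := by rw [two_mul, Real.exp_add, sq]
  simp only [squeeze, squeezeGen, Polynomial.eval_add, Polynomial.eval_sub, Polynomial.eval_mul,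
    Polynomial.eval_C, Polynomial.eval_X, Polynomial.eval_pow, Function.comp_apply, Pi.mul_apply,
    Pi.neg_apply]
  rw [e]
  ring

lemma continuous_mul_squeeze (p q : Polynomial ℝ) (τ : ℝ) :
    Continuous fun x => p.eval x * squeeze τ (fun y => q.eval y) x := by
  unfold squeeze
  have := p.continuous
  have := q.continuous
  fun_prop

lemma exists_abs_mul_squeeze_le (p q : Polynomial ℝ) :
    ∃ C, ∀ τ ∈ Set.Ioo (-(1 / 4) : ℝ) (1 / 4), ∀ x,
      |p.eval x * squeeze τ (fun y => q.eval y) x| ≤ C * Real.exp (7 / 32 * x ^ 2) := by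
  obtain ⟨C, hC, hp⟩ := p.exists_abs_eval_le_exp_sq (ε := 1 / 32) (by norm_num)
  obtain ⟨D, hD, hq⟩ := q.exists_abs_eval_le_exp_sq (ε := 1 / 32) (by norm_num)
  refine ⟨2 * C * D, fun τ hτ x => ?_⟩
  have hhalf : Real.exp (1 / 2) ≤ 2 := by
    have h : Real.exp (1 / 2) ^ 2 = Real.exp 1 := by
      rw [← Real.exp_nat_mul]; norm_num
    nlinarith [Real.exp_one_lt_d9, Real.exp_pos (1 / 2)]
  have h1 : Real.exp (τ / 2) ≤ 2 := (Real.exp_le_exp.2 (by linarith [hτ.2])).trans hhalf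
  have h2 : Real.exp (2 * τ) ≤ 2 := (Real.exp_le_exp.2 (by linarith [hτ.2])).trans hhalf
  have h3 : 1 / 2 ≤ Real.exp (2 * τ) := by linarith [Real.add_one_le_exp (2 * τ), hτ.1]
  have h4 : Real.exp (-((Real.exp (2 * τ) - 1) / 4) * x ^ 2) ≤ Real.exp (1 / 8 * x ^ 2) :=
    Real.exp_le_exp.2 (mul_le_mul_of_nonneg_right (by linarith) (sq_nonneg x))
  have h5 : |q.eval (Real.exp τ * x)| ≤ D * Real.exp (1 / 16 * x ^ 2) := by
    refine (hq _).trans (mul_le_mul_of_nonneg_left (Real.exp_le_exp.2 ?_) hD)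
    have e : Real.exp (2 * τ) = Real.exp τ ^ 2 := by rw [two_mul, Real.exp_add, sq]
    rw [mul_pow, ← e]
    nlinarith [sq_nonneg x]
  have e : Real.exp (7 / 32 * x ^ 2) = Real.exp (1 / 32 * x ^ 2) * Real.exp (1 / 8 * x ^ 2) *
      Real.exp (1 / 16 * x ^ 2) := by
    rw [← Real.exp_add, ← Real.exp_add]; ring_nf
  simp only [squeeze, abs_mul, Real.abs_exp]
  calc |p.eval x| * (Real.exp (τ / 2) * Real.exp (-((Real.exp (2 * τ) - 1) / 4) * x ^ 2) *
        |q.eval (Real.exp τ * x)|)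
      ≤ (C * Real.exp (1 / 32 * x ^ 2)) * (2 * Real.exp (1 / 8 * x ^ 2) *
        (D * Real.exp (1 / 16 * x ^ 2))) := by
        gcongr
        exact hp x
    _ = _ := by rw [e]; ring

lemma hasDerivAt_polyOverlap (p q : Polynomial ℝ) {τ : ℝ}
    (hτ : τ ∈ Set.Ioo (-(1 / 4) : ℝ) (1 / 4)) :
    HasDerivAt (polyOverlap p q) (polyOverlap p (squeezeGen q) τ) τ := by
  obtain ⟨C, hC⟩ := exists_abs_mul_squeeze_le p q
  obtain ⟨D, hD⟩ := exists_abs_mul_squeeze_le p (squeezeGen q)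
  have hint := integrable_exp_mul_sq_stdGaussian (c := 7 / 32) (by norm_num)
  exact (hasDerivAt_integral_of_dominated_loc_of_deriv_le (μ := stdGaussian)
    (F := fun τ x => p.eval x * squeeze τ (fun y => q.eval y) x)
    (F' := fun τ x => p.eval x * squeeze τ (fun y => (squeezeGen q).eval y) x)
    (Ioo_mem_nhds hτ.1 hτ.2)
    (Filter.Eventually.of_forall fun τ => (continuous_mul_squeeze p q τ).aestronglyMeasurable)
    ((hint.const_mul C).mono' (continuous_mul_squeeze p q τ).aestronglyMeasurable
      (Filter.Eventually.of_forall (hC τ hτ)))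
    (continuous_mul_squeeze p _ τ).aestronglyMeasurable
    (Filter.Eventually.of_forall fun x σ hσ => hD σ hσ x) (hint.const_mul D)
    (Filter.Eventually.of_forall fun x σ _ => (hasDerivAt_squeeze q x σ).const_mul _)).2

lemma contDiffOn_polyOverlap (p q : Polynomial ℝ) :
    ContDiffOn ℝ (⊤ : ℕ∞) (polyOverlap p q) (Set.Ioo (-(1 / 4)) (1 / 4)) := by
  rw [contDiffOn_infty]
  intro k
  induction k generalizing q with
  | zero =>
    exact contDiffOn_zero.2 fun τ hτ =>
      (hasDerivAt_polyOverlap p q hτ).continuousAt.continuousWithinAt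
  | succ k ih =>
    rw [Nat.cast_succ, contDiffOn_succ_iff_deriv_of_isOpen isOpen_Ioo]
    refine ⟨fun τ hτ => (hasDerivAt_polyOverlap p q hτ).differentiableAt.differentiableWithinAt,
      by simp, (ih (squeezeGen q)).congr fun τ hτ => (hasDerivAt_polyOverlap p q hτ).deriv⟩

lemma overlapFn_eq_polyOverlap (n : ℕ) :
    overlapFn n = fun τ => polyOverlap (hermiteReal n) (hermiteReal n) τ / n.factorial := by
  have hHe : ∀ x, He n x = (hermiteReal n).eval x := fun x => by
    simp [He, hermiteReal, Polynomial.aeval_def, Polynomial.eval_map]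
  funext τ
  rw [overlapFn, polyOverlap, ← integral_div]
  refine integral_congr_ae (Filter.Eventually.of_forall fun x => ?_)
  have hs : √(n.factorial : ℝ) * √(n.factorial : ℝ) = n.factorial :=
    Real.mul_self_sqrt (Nat.cast_nonneg _)
  simp only [hermN, squeeze, hHe]
  rw [mul_div_assoc', div_mul_div_comm, hs]

/-- Integrating a derivative bound `O(|τ|ᵏ)` gives `F = O(|τ|ᵏ⁺¹)` when `F 0 = 0`. -/
lemma isBigO_abs_pow_succ_of_hasDerivAt {F F' : ℝ → ℝ} {k : ℕ}
    (hF : ∀ᶠ τ in nhds 0, HasDerivAt F (F' τ) τ) (h0 : F 0 = 0)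
    (hO : F' =O[nhds 0] fun τ => |τ| ^ k) : F =O[nhds 0] fun τ => |τ| ^ (k + 1) := by
  obtain ⟨C, hC, hb⟩ := hO.exists_nonneg
  obtain ⟨ε, hε, hball⟩ := Metric.eventually_nhds_iff.1 (hF.and hb.bound)
  refine IsBigO.of_bound C (Metric.eventually_nhds_iff.2 ⟨ε, hε, fun τ hτ => ?_⟩)
  rw [Real.dist_0_eq_abs] at hτ
  have hmem : ∀ σ ∈ Metric.closedBall (0 : ℝ) |τ|, |σ| ≤ |τ| := fun σ hσ => by
    simpa [Real.dist_0_eq_abs] using hσ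
  have := Convex.norm_image_sub_le_of_norm_hasDerivWithin_le (f := F) (f' := F')
    (s := Metric.closedBall (0 : ℝ) |τ|) (C := C * |τ| ^ k) (x := 0) (y := τ)
    (fun σ hσ => (hball (by simpa using (hmem σ hσ).trans_lt hτ)).1.hasDerivWithinAt)
    (fun σ hσ => ((hball (by simpa using (hmem σ hσ).trans_lt hτ)).2).trans (by
      rw [Real.norm_of_nonneg (by positivity)]
      exact mul_le_mul_of_nonneg_left (pow_le_pow_left₀ (abs_nonneg _) (hmem σ hσ) k) hC))
    (convex_closedBall _ _) (by simp) (by simp)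
  rw [h0, sub_zero, sub_zero] at this
  rw [Real.norm_of_nonneg (by positivity : (0 : ℝ) ≤ |τ| ^ (k + 1)), pow_succ, ← mul_assoc]
  exact this

/-- A third order expansion `f τ = 1 - a² τ² / 2 + O(|τ|³)` with `a > 0` determines
`arccos (f τ) = a |τ| + O(τ²)`. -/
lemma isBigO_arccos_sub_of_isBigO {f : ℝ → ℝ} {a : ℝ} (ha : 0 < a)
    (hO : (fun τ => f τ - (1 - a ^ 2 / 2 * τ ^ 2)) =O[nhds 0] fun τ => |τ| ^ 3) :
    (fun τ => Real.arccos (f τ) - a * |τ|) =O[nhds 0] fun τ => τ ^ 2 := by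
  obtain ⟨C, hC, hb⟩ := hO.exists_pos
  have habs : Filter.Tendsto (fun τ : ℝ => |τ|) (nhds 0) (nhds 0) := by
    simpa using (continuous_abs (G := ℝ)).tendsto 0
  have hsmall : ∀ {r : ℝ}, 0 < r → ∀ᶠ τ : ℝ in nhds 0, |τ| < r := fun hr =>
    habs.eventually_lt_const hr
  have hf : Filter.Tendsto f (nhds 0) (nhds 1) := by
    have h1 : Filter.Tendsto (fun τ : ℝ => |τ| ^ 3) (nhds 0) (nhds 0) := by
      simpa using habs.pow 3
    have h2 : Filter.Tendsto (fun τ : ℝ => 1 - a ^ 2 / 2 * τ ^ 2) (nhds 0) (nhds 1) := by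
      have : Continuous fun τ : ℝ => 1 - a ^ 2 / 2 * τ ^ 2 := by fun_prop
      simpa using this.tendsto 0
    simpa using (hO.trans_tendsto h1).add h2
  have hθ : Filter.Tendsto (fun τ => Real.arccos (f τ)) (nhds 0) (nhds 0) := by
    simpa [Function.comp_def] using (Real.continuous_arccos.tendsto 1).comp hf
  refine IsBigO.of_bound (Real.pi ^ 2 / (2 * a) * (C + a ^ 4)) ?_
  filter_upwards [hb.bound, hsmall one_pos, hsmall (r := 1 / a) (by positivity),
    hsmall (r := a ^ 2 / (2 * C)) (by positivity),
    hf.eventually_const_le (show (-1 : ℝ) < 1 by norm_num),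
    hθ.eventually_lt_const one_pos] with τ hτ h1 h2 h3 h4 h5
  rw [Real.norm_eq_abs, Real.norm_of_nonneg (by positivity)] at hτ
  rw [Real.norm_eq_abs, Real.norm_of_nonneg (by positivity), ← sq_abs τ]
  rw [← sq_abs τ] at hτ
  set t := |τ| with ht
  have ht0 : 0 ≤ t := abs_nonneg τ
  have hle : f τ ≤ 1 := by
    rw [lt_div_iff₀ (by positivity)] at h3
    have := (abs_le.1 hτ).2
    nlinarith [mul_nonneg (sq_nonneg t) (sub_nonneg.2 h3.le)]
  have hcosθ := Real.cos_arccos h4 hle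
  have hθ0 := Real.arccos_nonneg (f τ)
  set θ := Real.arccos (f τ) with hθdef
  have hφ1 : a * t < 1 := by rwa [lt_div_iff₀' ha] at h2
  have hφ0 : 0 ≤ a * t := by positivity
  have hcosφ := Real.cos_bound (x := a * t) (by rw [abs_of_nonneg hφ0]; exact hφ1.le)
  have hdiff : |Real.cos θ - Real.cos (a * t)| ≤ (C + a ^ 4) * t ^ 3 := by
    rw [abs_of_nonneg hφ0] at hcosφ
    have h6 : (a * t) ^ 4 * (5 / 96) ≤ a ^ 4 * t ^ 3 := by
      have h7 : t ^ 4 ≤ t ^ 3 := pow_le_pow_of_le_one ht0 h1.le (by norm_num)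
      have h8 : a ^ 4 * t ^ 4 ≤ a ^ 4 * t ^ 3 := by gcongr
      have h9 : 0 ≤ a ^ 4 * t ^ 4 := by positivity
      rw [mul_pow]; linarith
    rw [hcosθ]
    obtain ⟨u1, u2⟩ := abs_le.1 hτ
    obtain ⟨v1, v2⟩ := abs_le.1 hcosφ
    rw [abs_le]
    constructor <;> nlinarith
  have hpi := Real.pi_gt_three
  have hsin1 := Real.mul_abs_le_abs_sin (x := (θ + a * t) / 2)
    (by rw [abs_of_nonneg (by positivity)]; linarith)
  have hsin2 := Real.mul_abs_le_abs_sin (x := (θ - a * t) / 2)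
    (by rw [abs_le]; constructor <;> linarith)
  have hlow : 2 / Real.pi ^ 2 * (a * t) * |θ - a * t| ≤ |Real.cos θ - Real.cos (a * t)| := by
    rw [Real.cos_sub_cos, abs_mul, abs_mul]
    rw [abs_of_nonneg (by positivity : 0 ≤ (θ + a * t) / 2)] at hsin1
    rw [abs_div, abs_two] at hsin2
    have h6 : 2 / Real.pi * (a * t / 2) ≤ |Real.sin ((θ + a * t) / 2)| :=
      le_trans (by gcongr; linarith) hsin1
    calc 2 / Real.pi ^ 2 * (a * t) * |θ - a * t|
        = |(-2 : ℝ)| * (2 / Real.pi * (a * t / 2)) * (2 / Real.pi * (|θ - a * t| / 2)) := by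
          rw [abs_neg, abs_two]; field_simp
      _ ≤ _ := by gcongr
  rcases ht0.eq_or_lt with h0 | hpos
  · have hf0 : f τ = 1 := by
      rw [← h0] at hτ
      have := abs_nonpos_iff.1 (hτ.trans_eq (by ring))
      linarith
    rw [← h0, hθdef, hf0]
    simp
  · have h6 := hlow.trans hdiff
    have h7 : 0 < 2 / Real.pi ^ 2 * (a * t) := by positivity
    refine le_of_mul_le_mul_left (h6.trans_eq ?_) h7
    field_simp

/-- For every `n`, the function `f(τ) = ⟨h_n, T_τ h_n⟩_{L²(γ)}` is smooth near `τ = 0`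
with `f(0) = 1`, `f′(0) = 0`, `f″(0) = −(n²+n+1)/2`; consequently
`f(τ) = 1 − ((n²+n+1)/4)τ² + O(τ³)` and
`arccos f(τ) = √((n²+n+1)/2)·|τ| + O(τ²)` as `τ → 0`. -/
theorem squeeze_overlap_asymptotics (n : ℕ) :
    (∃ u ∈ nhds (0 : ℝ), ContDiffOn ℝ (⊤ : ℕ∞) (overlapFn n) u) ∧
    overlapFn n 0 = 1 ∧
    deriv (overlapFn n) 0 = 0 ∧
    deriv (deriv (overlapFn n)) 0 = -(((n : ℝ) ^ 2 + n + 1) / 2) ∧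
    (fun τ : ℝ => overlapFn n τ - (1 - (((n : ℝ) ^ 2 + n + 1) / 4) * τ ^ 2))
      =O[nhds (0 : ℝ)] (fun τ : ℝ => |τ| ^ 3) ∧
    (fun τ : ℝ =>
        Real.arccos (overlapFn n τ) - Real.sqrt (((n : ℝ) ^ 2 + n + 1) / 2) * |τ|)
      =O[nhds (0 : ℝ)] (fun τ : ℝ => τ ^ 2) := by
  set p := hermiteReal n with hp
  set K : ℝ := (n : ℝ) ^ 2 + n + 1 with hK
  have hfac : (n.factorial : ℝ) ≠ 0 := Nat.cast_ne_zero.2 n.factorial_ne_zero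
  have hnhds : Set.Ioo (-(1 / 4) : ℝ) (1 / 4) ∈ nhds (0 : ℝ) :=
    Ioo_mem_nhds (by norm_num) (by norm_num)
  have hmem : (0 : ℝ) ∈ Set.Ioo (-(1 / 4) : ℝ) (1 / 4) := mem_of_mem_nhds hnhds
  set g : Polynomial ℝ → ℝ → ℝ := fun q τ => polyOverlap p q τ / n.factorial with hg
  have hf : overlapFn n = g p := overlapFn_eq_polyOverlap n
  have hder : ∀ q, ∀ τ ∈ Set.Ioo (-(1 / 4) : ℝ) (1 / 4),
      HasDerivAt (g q) (g (squeezeGen q) τ) τ :=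
    fun q τ hτ => (hasDerivAt_polyOverlap p q hτ).div_const _
  have hg0 : g p 0 = 1 := by
    simp only [hg, polyOverlap_zero, hp, gaussExp_hermiteReal_sq, div_self hfac]
  have hg1 : g (squeezeGen p) 0 = 0 := by
    simp only [hg, polyOverlap_zero, hp, gaussExp_hermiteReal_mul_squeezeGen, zero_div]
  have hg2 : g (squeezeGen (squeezeGen p)) 0 = -(K / 2) := by
    simp only [hg, polyOverlap_zero, hp, gaussExp_hermiteReal_mul_squeezeGen_squeezeGen]
    rw [mul_div_assoc, div_self hfac, mul_one]
  have hderiv : deriv (g p) =ᶠ[nhds 0] g (squeezeGen p) :=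
    Filter.eventually_of_mem hnhds fun τ hτ => (hder p τ hτ).deriv
  have hO2 : (fun τ => g (squeezeGen (squeezeGen p)) τ + K / 2)
      =O[nhds 0] fun τ : ℝ => |τ| ^ 1 := by
    have h := (hder (squeezeGen (squeezeGen p)) 0 hmem).isBigO_sub
    simp only [hg2, sub_zero, sub_neg_eq_add] at h
    simpa only [pow_one] using h.abs_right
  have hO1 : (fun τ => g (squeezeGen p) τ + K / 2 * τ) =O[nhds 0] fun τ : ℝ => |τ| ^ 2 :=
    isBigO_abs_pow_succ_of_hasDerivAt (Filter.eventually_of_mem hnhds fun τ hτ =>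
      ((hder (squeezeGen p) τ hτ).add ((hasDerivAt_id τ).const_mul (K / 2))).congr_deriv
        (by rw [mul_one])) (by simp [hg1]) hO2
  have hO0 : (fun τ => g p τ - (1 - K / 4 * τ ^ 2)) =O[nhds 0] fun τ : ℝ => |τ| ^ 3 :=
    isBigO_abs_pow_succ_of_hasDerivAt (Filter.eventually_of_mem hnhds fun τ hτ =>
      ((hder p τ hτ).sub ((((hasDerivAt_id τ).pow 2).const_mul (K / 4)).const_sub 1)).congr_deriv
        (by simp; ring)) (by simp [hg0]) hO1
  rw [hf]
  refine ⟨⟨_, hnhds, (contDiffOn_polyOverlap p p).div_const _⟩, hg0,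
    (hder p 0 hmem).deriv.trans hg1, ?_, hO0, isBigO_arccos_sub_of_isBigO (by positivity) ?_⟩
  · rw [hderiv.deriv_eq, (hder (squeezeGen p) 0 hmem).deriv, hg2]
  · rw [Real.sq_sqrt (by positivity), div_div, show (2 : ℝ) * 2 = 4 by norm_num]
    exact hO0
end
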